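/- arXiv:1003.0475 — 3 statements merged into one kernel-verified Lean document; each statement's English description precedes it below -/
import Mathlib

section
/- There exist seven real polynomials p_1, …, p_7 in the entries of a 4×4 symmetric matrix, each homogeneous of degree 6, such that the discriminant satisfies δ(A) = p_1(A)² + ⋯ + p_7(A)² for every 4×4 real symmetric matrix A. -/
open Matrix BigOperators

/-- A real symmetric matrix is Hermitian. -/
theorem isHermitian_of_isSymm {n : ℕ} {A : Matrix (Fin n) (Fin n) ℝ} (h : A.IsSymm) :
    A.IsHermitian := by
  rw [Matrix.IsHermitian, Matrix.conjTranspose_eq_transpose_of_trivial]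
  exact h

/-- The discriminant of a real symmetric (Hermitian) matrix: the product of the squared
differences of its eigenvalues. -/
noncomputable def disc {n : ℕ} (A : Matrix (Fin n) (Fin n) ℝ) (hA : A.IsHermitian) : ℝ :=
  ∏ i : Fin n, ∏ j ∈ Finset.Ioi i, (hA.eigenvalues i - hA.eigenvalues j) ^ 2

/-- The space `N` of trace-zero real symmetric `n × n` matrices, as a submodule. -/
def symTraceless (n : ℕ) : Submodule ℝ (Matrix (Fin n) (Fin n) ℝ) where
  carrier := {A | A.IsSymm ∧ A.trace = 0}
  add_mem' := by
    rintro A B ⟨hA1, hA2⟩ ⟨hB1, hB2⟩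
    refine ⟨?_, ?_⟩
    · rw [Matrix.IsSymm, Matrix.transpose_add, hA1, hB1]
    · rw [Matrix.trace_add, hA2, hB2, add_zero]
  zero_mem' := ⟨by rw [Matrix.IsSymm, Matrix.transpose_zero], by simp⟩
  smul_mem' := by
    rintro c A ⟨h1, h2⟩
    refine ⟨?_, ?_⟩
    · rw [Matrix.IsSymm, Matrix.transpose_smul, h1]
    · rw [Matrix.trace_smul, h2, smul_zero]

theorem mem_symTraceless {n : ℕ} {A : Matrix (Fin n) (Fin n) ℝ} :
    A ∈ symTraceless n ↔ A.IsSymm ∧ A.trace = 0 := Iff.rfl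

/-- The eigenvalues of a trace-zero real symmetric matrix. -/
noncomputable def eigsN {n : ℕ} (A : symTraceless n) : Fin n → ℝ :=
  (isHermitian_of_isSymm (mem_symTraceless.mp A.2).1).eigenvalues

/-- A trace-zero symmetric matrix is degenerate if it has a repeated eigenvalue. -/
def Degen {n : ℕ} (A : symTraceless n) : Prop :=
  ∃ i j : Fin n, i ≠ j ∧ eigsN A i = eigsN A j

/-- The discriminant, as a function on trace-zero symmetric matrices. -/
noncomputable def discN {n : ℕ} (A : symTraceless n) : ℝ :=
  ∏ i : Fin n, ∏ j ∈ Finset.Ioi i, (eigsN A i - eigsN A j) ^ 2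

/-- Evaluation of a polynomial in the matrix entries at a matrix. -/
noncomputable def evalMat {n : ℕ} (p : MvPolynomial (Fin n × Fin n) ℝ)
    (A : Matrix (Fin n) (Fin n) ℝ) : ℝ :=
  MvPolynomial.eval (fun ij => A ij.1 ij.2) p

/-- The action `A ↦ gᵀ A g` of an orthogonal matrix on trace-zero symmetric matrices. -/
def soConj {n : ℕ} (g : Matrix (Fin n) (Fin n) ℝ) (hg : gᵀ * g = 1)
    (A : symTraceless n) : symTraceless n :=
  ⟨gᵀ * A.1 * g, by
    obtain ⟨h1, h2⟩ := mem_symTraceless.mp A.2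
    refine mem_symTraceless.mpr ⟨?_, ?_⟩
    · rw [Matrix.IsSymm, Matrix.transpose_mul, Matrix.transpose_mul,
        Matrix.transpose_transpose, h1, Matrix.mul_assoc]
    · rw [Matrix.trace_mul_cycle, mul_eq_one_comm.mp hg,
        Matrix.one_mul, h2]⟩

/-- `H_i(A) = A^i - (Tr(A^i)/n)·I`. -/
noncomputable def Hmat {n : ℕ} (A : Matrix (Fin n) (Fin n) ℝ) (i : ℕ) :
    Matrix (Fin n) (Fin n) ℝ :=
  A ^ i - ((A ^ i).trace / (n : ℝ)) • 1

/-- The resolvent 3 by 3 matrix (rotation-matrix formula). -/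
def resM {R : Type*} [CommRing R] (A : Fin 4 → Fin 4 → R) : Matrix (Fin 3) (Fin 3) R :=
  !![A 0 0 + A 1 1 - A 2 2 - A 3 3, (A 1 2 - A 0 3) + (A 1 2 - A 0 3),
      (A 1 3 + A 0 2) + (A 1 3 + A 0 2);
    (A 1 2 + A 0 3) + (A 1 2 + A 0 3), A 0 0 - A 1 1 + A 2 2 - A 3 3,
      (A 2 3 - A 0 1) + (A 2 3 - A 0 1);
    (A 1 3 - A 0 2) + (A 1 3 - A 0 2), (A 2 3 + A 0 1) + (A 2 3 + A 0 1),
      A 0 0 - A 1 1 - A 2 2 + A 3 3]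

/-- `M Mᵀ`, entrywise. -/
def resS {R : Type*} [CommRing R] (M : Matrix (Fin 3) (Fin 3) R) (i j : Fin 3) : R :=
  M i 0 * M j 0 + M i 1 * M j 1 + M i 2 * M j 2

/-- `S ^ 2`, entrywise. -/
def sqS {R : Type*} [CommRing R] (S : Fin 3 → Fin 3 → R) (i j : Fin 3) : R :=
  S i 0 * S 0 j + S i 1 * S 1 j + S i 2 * S 2 j

/-- Coefficient of `v_i ^ 3` in `det [v, S v, T v]`. -/
def cube {R : Type*} [CommRing R] (S T : Fin 3 → Fin 3 → R) (i j k : Fin 3) : R :=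
  S j i * T k i - S k i * T j i

/-- Difference of the coefficients of `v_i v_j ^ 2` and `v_i v_k ^ 2`. -/
def dif {R : Type*} [CommRing R] (S T : Fin 3 → Fin 3 → R) (i j k : Fin 3) : R :=
  (S j j * T k j - S k j * T j j + S k i * T i j + S k j * T i i - S i i * T k j - S i j * T k i)
  - (S j k * T k k - S k k * T j k + S i i * T j k + S i k * T j i - S j i * T i k - S j k * T i i)

/-- Coefficient of `v_0 v_1 v_2`. -/
def mid {R : Type*} [CommRing R] (S T : Fin 3 → Fin 3 → R) : R :=
  S 1 1 * T 2 2 + S 1 2 * T 2 1 - S 2 1 * T 1 2 - S 2 2 * T 1 1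
  + S 2 0 * T 0 2 + S 2 2 * T 0 0 - S 0 0 * T 2 2 - S 0 2 * T 2 0
  + S 0 0 * T 1 1 + S 0 1 * T 1 0 - S 1 0 * T 0 1 - S 1 1 * T 0 0

/-- The seven polynomials, before scaling. -/
def seven {R : Type*} [CommRing R] (r : R) (S T : Fin 3 → Fin 3 → R) : Fin 7 → R :=
  ![mid S T, r * cube S T 0 1 2, r * cube S T 1 2 0, r * cube S T 2 0 1,
    dif S T 0 1 2, dif S T 1 2 0, dif S T 2 0 1]

theorem seven_sq (r : ℝ) (hr : r ^ 2 = 15) (S : Fin 3 → Fin 3 → ℝ) (h1 : S 1 0 = S 0 1)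
    (h2 : S 2 0 = S 0 2) (h3 : S 2 1 = S 1 2) (e1 e2 e3 : ℝ)
    (he1 : S 0 0 + S 1 1 + S 2 2 = e1)
    (he2 : S 0 0 * S 1 1 - S 0 1 ^ 2 + (S 0 0 * S 2 2 - S 0 2 ^ 2)
      + (S 1 1 * S 2 2 - S 1 2 ^ 2) = e2)
    (he3 : S 0 0 * S 1 1 * S 2 2 + 2 * S 0 1 * S 0 2 * S 1 2 - S 0 0 * S 1 2 ^ 2
      - S 1 1 * S 0 2 ^ 2 - S 2 2 * S 0 1 ^ 2 = e3) :
    ∑ i, seven r S (sqS S) i ^ 2 =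
      e1 ^ 2 * e2 ^ 2 - 4 * e2 ^ 3 - 4 * e1 ^ 3 * e3 + 18 * e1 * e2 * e3 - 27 * e3 ^ 2 := by
  subst he1 he2 he3
  simp only [Fin.sum_univ_seven, seven]
  simp only [Matrix.cons_val]
  simp only [mul_pow, hr, mid, cube, dif, sqS, h1, h2, h3]
  generalize S 0 0 = a
  generalize S 0 1 = b
  generalize S 0 2 = c
  generalize S 1 1 = d
  generalize S 1 2 = e
  generalize S 2 2 = f
  ring

theorem resS_e (A : Matrix (Fin 4) (Fin 4) ℝ) (hA : A.IsSymm) (E1 E2 E3 E4 : ℝ)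
    (h : ∀ t : ℝ, (t • (1 : Matrix (Fin 4) (Fin 4) ℝ) - A).det
      = t ^ 4 - E1 * t ^ 3 + E2 * t ^ 2 - E3 * t + E4) (r : ℝ) (hr : r ^ 2 = 15) :
    ∑ i, seven r (resS (resM A)) (sqS (resS (resM A))) i ^ 2 =
    (fun e1 e2 e3 : ℝ => e1 ^ 2 * e2 ^ 2 - 4 * e2 ^ 3 - 4 * e1 ^ 3 * e3
      + 18 * e1 * e2 * e3 - 27 * e3 ^ 2) (3 * E1 ^ 2 - 8 * E2)
      (3 * E1 ^ 4 - 16 * E1 ^ 2 * E2 + 16 * E2 ^ 2 + 16 * E1 * E3 - 64 * E4)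
      ((E1 ^ 3 - 4 * E1 * E2 + 8 * E3) ^ 2) := by
  have s10 : A 1 0 = A 0 1 := hA.apply 0 1
  have s20 : A 2 0 = A 0 2 := hA.apply 0 2
  have s30 : A 3 0 = A 0 3 := hA.apply 0 3
  have s21 : A 2 1 = A 1 2 := hA.apply 1 2
  have s31 : A 3 1 = A 1 3 := hA.apply 1 3
  have s32 : A 3 2 = A 2 3 := hA.apply 2 3
  have k0 := h 0
  have k1 := h 1
  have k2 := h (-1)
  have k3 := h 2
  simp [Matrix.det_succ_row_zero, Fin.sum_univ_succ, Fin.succAbove, s10, s20, s30, s21, s31, s32,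
    Matrix.one_apply] at k0 k1 k2 k3
  obtain ⟨a, ha⟩ : ∃ x, x = A 0 0 := ⟨_, rfl⟩
  obtain ⟨b, hb⟩ : ∃ x, x = A 1 1 := ⟨_, rfl⟩
  obtain ⟨c, hc⟩ : ∃ x, x = A 2 2 := ⟨_, rfl⟩
  obtain ⟨d, hd⟩ : ∃ x, x = A 3 3 := ⟨_, rfl⟩
  obtain ⟨p, hp⟩ : ∃ x, x = A 0 1 := ⟨_, rfl⟩
  obtain ⟨q, hq⟩ : ∃ x, x = A 0 2 := ⟨_, rfl⟩
  obtain ⟨w, hw⟩ : ∃ x, x = A 0 3 := ⟨_, rfl⟩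
  obtain ⟨s, hs⟩ : ∃ x, x = A 1 2 := ⟨_, rfl⟩
  obtain ⟨u, hu⟩ : ∃ x, x = A 1 3 := ⟨_, rfl⟩
  obtain ⟨v, hv⟩ : ∃ x, x = A 2 3 := ⟨_, rfl⟩
  simp only [← ha, ← hb, ← hc, ← hd, ← hp, ← hq, ← hw, ← hs, ← hu, ← hv] at k0 k1 k2 k3
  have e1 : E1 = a + b + c + d := by
    linear_combination (-1/2) * k1 + (-1/6) * k2 + (1/6) * k3 + (1/2) * k0
  have e2 : E2 = a*b+a*c+a*d+b*c+b*d+c*d-p^2-q^2-w^2-s^2-u^2-v^2 := by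
    linear_combination (-1/2) * k1 + (-1/2) * k2 + k0
  have e3 : E3 = (a*b*c+2*p*q*s-a*s^2-b*q^2-c*p^2) + (a*b*d+2*p*w*u-a*u^2-b*w^2-d*p^2)
      + (a*c*d+2*q*w*v-a*v^2-c*w^2-d*q^2) + (b*c*d+2*s*u*v-b*v^2-c*u^2-d*s^2) := by
    linear_combination k1 + (-1/3) * k2 + (-1/6) * k3 + (-1/2) * k0
  have hdet : (resM A).det = E1 ^ 3 - 4 * E1 * E2 + 8 * E3 := by
    rw [e1, e2, e3, Matrix.det_fin_three]
    simp only [resM, Matrix.of_apply, Matrix.cons_val,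
      ← ha, ← hb, ← hc, ← hd, ← hp, ← hq, ← hw, ← hs, ← hu, ← hv]
    ring
  apply seven_sq r hr
  · simp only [resS]; ring
  · simp only [resS]; ring
  · simp only [resS]; ring
  · rw [e1, e2]
    simp only [resS, resM, Matrix.of_apply, Matrix.cons_val,
      ← ha, ← hb, ← hc, ← hd, ← hp, ← hq, ← hw, ← hs, ← hu, ← hv]
    ring
  · rw [← k0, e1, e2, e3]
    simp only [resS, resM, Matrix.of_apply, Matrix.cons_val,
      ← ha, ← hb, ← hc, ← hd, ← hp, ← hq, ← hw, ← hs, ← hu, ← hv]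
    ring
  · rw [← hdet, Matrix.det_fin_three]
    simp only [resS]
    ring

theorem evalMat_seven (A : Matrix (Fin 4) (Fin 4) ℝ) (r : ℝ) (i : Fin 7) :
    evalMat (MvPolynomial.C (1 / 64) * seven (MvPolynomial.C r)
      (resS (resM fun i j => (MvPolynomial.X (i, j) : MvPolynomial (Fin 4 × Fin 4) ℝ)))
      (sqS (resS (resM fun i j => MvPolynomial.X (i, j)))) i) A =
    1 / 64 * seven r (resS (resM A)) (sqS (resS (resM A))) i := by
  have hM : ∀ i j, MvPolynomial.eval (fun ij : Fin 4 × Fin 4 => A ij.1 ij.2)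
      (resM (fun i j => (MvPolynomial.X (i, j) : MvPolynomial (Fin 4 × Fin 4) ℝ)) i j)
      = resM A i j := by
    intro i j
    fin_cases i <;> fin_cases j <;> simp [resM]
  have hS : ∀ i j, MvPolynomial.eval (fun ij : Fin 4 × Fin 4 => A ij.1 ij.2)
      (resS (resM (fun i j => (MvPolynomial.X (i, j) : MvPolynomial (Fin 4 × Fin 4) ℝ))) i j)
      = resS (resM A) i j := by
    intro i j
    simp only [resS, map_add, map_mul, hM]
  have hT : ∀ i j, MvPolynomial.eval (fun ij : Fin 4 × Fin 4 => A ij.1 ij.2)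
      (sqS (resS (resM (fun i j => (MvPolynomial.X (i, j) : MvPolynomial (Fin 4 × Fin 4) ℝ)))) i j)
      = sqS (resS (resM A)) i j := by
    intro i j
    simp only [sqS, map_add, map_mul, hS]
  unfold evalMat
  rw [map_mul, MvPolynomial.eval_C]
  congr 1
  fin_cases i <;>
    simp only [seven, mid, cube, dif, Fin.zero_eta, Fin.mk_one, Fin.reduceFinMk, Matrix.cons_val,
      map_add, map_sub, map_mul, hS, hT, MvPolynomial.eval_C]

theorem seven_homog (r : ℝ) (i : Fin 7) :
    (MvPolynomial.C (1 / 64) * seven (MvPolynomial.C r)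
      (resS (resM fun i j => (MvPolynomial.X (i, j) : MvPolynomial (Fin 4 × Fin 4) ℝ)))
      (sqS (resS (resM fun i j => MvPolynomial.X (i, j)))) i).IsHomogeneous 6 := by
  have hX : ∀ i j, (MvPolynomial.X (i, j) : MvPolynomial (Fin 4 × Fin 4) ℝ).IsHomogeneous 1 :=
    fun i j => MvPolynomial.isHomogeneous_X _ _
  have hM : ∀ i j, (resM (fun i j => (MvPolynomial.X (i, j) :
      MvPolynomial (Fin 4 × Fin 4) ℝ)) i j).IsHomogeneous 1 := by
    intro i j
    fin_cases i <;> fin_cases j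
    · exact (((hX _ _).add (hX _ _)).sub (hX _ _)).sub (hX _ _)
    · exact ((hX _ _).sub (hX _ _)).add ((hX _ _).sub (hX _ _))
    · exact ((hX _ _).add (hX _ _)).add ((hX _ _).add (hX _ _))
    · exact ((hX _ _).add (hX _ _)).add ((hX _ _).add (hX _ _))
    · exact (((hX _ _).sub (hX _ _)).add (hX _ _)).sub (hX _ _)
    · exact ((hX _ _).sub (hX _ _)).add ((hX _ _).sub (hX _ _))
    · exact ((hX _ _).sub (hX _ _)).add ((hX _ _).sub (hX _ _))
    · exact ((hX _ _).add (hX _ _)).add ((hX _ _).add (hX _ _))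
    · exact (((hX _ _).sub (hX _ _)).sub (hX _ _)).add (hX _ _)
  generalize resM (fun i j => (MvPolynomial.X (i, j) : MvPolynomial (Fin 4 × Fin 4) ℝ)) = M at hM ⊢
  have hS : ∀ i j, (resS M i j).IsHomogeneous 2 := by
    intro i j
    exact (((hM _ _).mul (hM _ _)).add ((hM _ _).mul (hM _ _))).add ((hM _ _).mul (hM _ _))
  generalize resS M = S at hS ⊢
  have hT : ∀ i j, (sqS S i j).IsHomogeneous 4 := by
    intro i j
    exact (((hS _ _).mul (hS _ _)).add ((hS _ _).mul (hS _ _))).add ((hS _ _).mul (hS _ _))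
  generalize sqS S = T at hT ⊢
  have hST : ∀ i j k l, (S i j * T k l).IsHomogeneous 6 := fun i j k l => (hS i j).mul (hT k l)
  have hc : ∀ i j k, (cube S T i j k).IsHomogeneous 6 := fun i j k =>
    (hST _ _ _ _).sub (hST _ _ _ _)
  have hd : ∀ i j k, (dif S T i j k).IsHomogeneous 6 := fun i j k =>
    ((((((hST _ _ _ _).sub (hST _ _ _ _)).add (hST _ _ _ _)).add (hST _ _ _ _)).sub
      (hST _ _ _ _)).sub (hST _ _ _ _)).sub
    ((((((hST _ _ _ _).sub (hST _ _ _ _)).add (hST _ _ _ _)).add (hST _ _ _ _)).sub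
      (hST _ _ _ _)).sub (hST _ _ _ _))
  have hm : (mid S T).IsHomogeneous 6 :=
    ((((((((((((hST _ _ _ _).add (hST _ _ _ _)).sub (hST _ _ _ _)).sub (hST _ _ _ _)).add
      (hST _ _ _ _)).add (hST _ _ _ _)).sub (hST _ _ _ _)).sub (hST _ _ _ _)).add
      (hST _ _ _ _)).add (hST _ _ _ _)).sub (hST _ _ _ _)).sub (hST _ _ _ _))
  refine MvPolynomial.IsHomogeneous.C_mul ?_ _
  fin_cases i
  · exact hm
  · exact (hc 0 1 2).C_mul _
  · exact (hc 1 2 0).C_mul _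
  · exact (hc 2 0 1).C_mul _
  · exact hd 0 1 2
  · exact hd 1 2 0
  · exact hd 2 0 1

theorem resolvent_disc (e1 e2 e3 x y z : ℝ) (h1 : e1 = x + y + z)
    (h2 : e2 = x * y + x * z + y * z) (h3 : e3 = x * y * z) :
    (fun e1 e2 e3 : ℝ => e1 ^ 2 * e2 ^ 2 - 4 * e2 ^ 3 - 4 * e1 ^ 3 * e3
      + 18 * e1 * e2 * e3 - 27 * e3 ^ 2) e1 e2 e3 = ((x - y) * (x - z) * (y - z)) ^ 2 := by
  subst h1 h2 h3
  ring

/-- The discriminant of `4 × 4` real symmetric matrices can be written as a sum of seven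
squares of homogeneous polynomials of degree 6. -/
theorem discriminant_four_sum_of_seven_squares :
    ∃ p : Fin 7 → MvPolynomial (Fin 4 × Fin 4) ℝ,
      (∀ i, (p i).IsHomogeneous 6) ∧
      ∀ (A : Matrix (Fin 4) (Fin 4) ℝ) (hA : A.IsSymm),
        disc A (isHermitian_of_isSymm hA) = ∑ i, (evalMat (p i) A) ^ 2 := by
  refine ⟨_, seven_homog (Real.sqrt 15), ?_⟩
  intro A hA
  simp only [evalMat_seven, mul_pow, ← Finset.mul_sum]
  have hc := (isHermitian_of_isSymm hA).charpoly_eq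
  unfold disc
  generalize (isHermitian_of_isSymm hA).eigenvalues = l at hc ⊢
  have h : ∀ t : ℝ, (t • (1 : Matrix (Fin 4) (Fin 4) ℝ) - A).det
      = t ^ 4 - (l 0 + l 1 + l 2 + l 3) * t ^ 3
        + (l 0 * l 1 + l 0 * l 2 + l 0 * l 3 + l 1 * l 2 + l 1 * l 3 + l 2 * l 3) * t ^ 2
        - (l 0 * l 1 * l 2 + l 0 * l 1 * l 3 + l 0 * l 2 * l 3 + l 1 * l 2 * l 3) * t
        + l 0 * l 1 * l 2 * l 3 := by
    intro t
    have := congrArg (Polynomial.eval t) hc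
    rw [Matrix.eval_charpoly, Polynomial.eval_prod] at this
    rw [Matrix.smul_one_eq_diagonal, ← Matrix.scalar_apply, this]
    simp [Fin.prod_univ_four]
    ring
  rw [resS_e A hA _ _ _ _ h (Real.sqrt 15) (Real.sq_sqrt (by norm_num))]
  have i0 : Finset.Ioi (0 : Fin 4) = {1, 2, 3} := by decide
  have i1 : Finset.Ioi (1 : Fin 4) = {2, 3} := by decide
  have i2 : Finset.Ioi (2 : Fin 4) = {3} := by decide
  have i3 : Finset.Ioi (3 : Fin 4) = ∅ := by decide
  rw [Fin.prod_univ_four, i0, i1, i2, i3]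
  obtain ⟨x, hx⟩ : ∃ x, x = l 0 + l 1 - l 2 - l 3 := ⟨_, rfl⟩
  obtain ⟨y, hy⟩ : ∃ y, y = l 0 - l 1 + l 2 - l 3 := ⟨_, rfl⟩
  obtain ⟨z, hz⟩ : ∃ z, z = l 0 - l 1 - l 2 + l 3 := ⟨_, rfl⟩
  rw [resolvent_disc _ _ _ (x ^ 2) (y ^ 2) (z ^ 2) (by subst hx hy hz; ring)
    (by subst hx hy hz; ring) (by rw [← mul_pow, ← mul_pow]; congr 1; subst hx hy hz; ring)]
  have d1 : x ^ 2 - y ^ 2 = 4 * ((l 0 - l 3) * (l 1 - l 2)) := by subst hx hy; ring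
  have d2 : x ^ 2 - z ^ 2 = 4 * ((l 0 - l 2) * (l 1 - l 3)) := by subst hx hz; ring
  have d3 : y ^ 2 - z ^ 2 = 4 * ((l 0 - l 1) * (l 2 - l 3)) := by subst hy hz; ring
  rw [d1, d2, d3]
  simp
  generalize l 0 - l 1 = a1
  generalize l 0 - l 2 = a2
  generalize l 0 - l 3 = a3
  generalize l 1 - l 2 = a4
  generalize l 1 - l 3 = a5
  generalize l 2 - l 3 = a6
  ring
end

section
/- For n = 4, the linear span of the polynomial functions A ↦ ξ(A ∧ H_2(A) ∧ H_3(A)) on N, as ξ ranges over all linear forms on ⋀³ N, has dimension 39 (equals 7 + 7 + 25, the dimensions of the three irreducible SO_4-module summands of this span). -/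
open Matrix BigOperators

/-- `H_i(A) = A^i - (Tr(A^i)/4)·I` as a trace-zero symmetric `4 × 4` matrix. -/
noncomputable def H4 (i : ℕ) (A : ↥(symTraceless 4)) : ↥(symTraceless 4) :=
  ⟨A.1 ^ i - ((A.1 ^ i).trace / 4) • 1, by
    obtain ⟨h1, h2⟩ := mem_symTraceless.mp A.2
    refine mem_symTraceless.mpr ⟨?_, ?_⟩
    · rw [Matrix.IsSymm, Matrix.transpose_sub, Matrix.transpose_smul, Matrix.transpose_one,
        Matrix.transpose_pow, h1]
    · rw [Matrix.trace_sub, Matrix.trace_smul, Matrix.trace_one]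
      simp only [Fintype.card_fin, smul_eq_mul]
      push_cast
      ring⟩

/-- The wedge product `A ∧ B ∧ C` in `⋀³ N`. -/
noncomputable def wedge3 (A B C : ↥(symTraceless 4)) : ↥(⋀[ℝ]^3 ↥(symTraceless 4)) :=
  ⟨ExteriorAlgebra.ιMulti ℝ 3 ![A, B, C], ExteriorAlgebra.ιMulti_range ℝ 3 ⟨![A, B, C], rfl⟩⟩

/-! ### Explicit certificates (modulo 7) -/

def wKCode : List ℕ :=
  [68, 132, 196, 148, 212, 228, 4, 84, 164, 72, 136, 200, 152, 216, 232, 8, 88, 168, 76, 140, 156,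
  220, 236, 12, 92, 172, 73, 137, 201, 153, 217, 233, 9, 89, 169, 77, 141, 157, 237, 13, 93, 173,
  78, 14, 94]

def wKCol : List ℕ :=
  [0, 1, 2, 3, 4, 5, 6, 7, 8, 9, 10, 11, 12, 13, 14, 15, 16, 17, 18, 19, 20, 21, 22, 23, 24, 25,
  26, 27, 28, 29, 30, 31, 32, 34, 35, 36, 37, 38, 39, 40, 41, 42, 43, 44, 45]

def wKM : List ℕ :=
  [424343434524322343552414563344351502524603524, 205665603240311336350363521131206163314552546,
  540661136544402001525443355043445010302622155, 124435264546215461354664034260054061200030230,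
  441566316560244666615143666150254235022560032, 441045044516224132052456013052362511623462252,
  555554650601635222525330554332205520410050602, 52642350202403003366542553031514241204043446,
  521452653615245066153151501005420242652032531, 206333055340534335234523036530626662436211046,
  155340530551560456654162512030651221466506555, 305605143364223223203442500122664261421615145,
  334165551363351141305010412313046414656052616, 502622605404231216500443311065633216524340063,
  601336610324010461465523521054526406202202611, 466553445461462566264266423366631234530116362,
  441642023312266250654330066215156402412331603, 436334255463624663343360433420413063402205525,
  40053000554140564255302024613554056616600155, 314432312520153243222666420106663654203233320,
  554410012302140220153554325152314433516561202, 451261415240231640612230131151422525155406042,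
  101514266066422014666236345063054554665256664, 13451300121106644516122314202213260256301226,
  465613261052635160113135001000324430132221551, 601063652654533122622535461032022066214354151,
  314005401411662056016006263456430221410541530, 343224663502053104366111026221406656205465023,
  246420551453343441525624204651216244526541240, 45256541466015101325655125041136301462444525,
  612130466631220026261015420214133343351325056, 643625351456353040022431444011650412530430235,
  664233433064452366116544345224506153004341441, 121361163131464265513050252621623061221223460,
  205056456046540322543412462503344400651536543, 626260604036434112533232343402452434513054503,
  165201063243102311231325614333160236322564353, 355304555265121155416010045306244165251023265,
  23335330500206564200521503030212021354133416, 235341151011346204216011344604320204502560640,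
  635022305432130441323122321255563360120105645, 524652604201456656200065162444050235552314223,
  352502611051064433136562102424644216250040402, 3110350566421603332155623112150262356142145,
  150636430145452316616004151444566360541313624]

def wKX : List ℕ :=
  [351664122105615334400445156621034132163504453, 563514543634255241332211223513214532406354153,
  232200363224304340262101015365204335364435104, 104336552246426152541624563116100523411613351,
  615614654504346352061134166454522601420221661, 621133213320151532025032004363515332201524353,
  32212443433043644123416621446632503015626201, 332320233413204546033001321010560336036310114,
  514206360043253226143313455164150323055163505, 14104140432302456554236440062025653142625556,
  632651324655316520235251434043005030011054250, 161545542533363532330466315234011244300345311,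
  305061353206421152605423610311100156405101356, 524532503466536411661546061513554245455012314,
  526664102663626033363462130213545216121214415, 350551253653241121512211245051423206303344663,
  50623414010346131504610356052253064431326633, 625412305360035530116443430431326401553450615,
  540556664633433333106254463655613666020253254, 2643260622315032002450654056065441140201326,
  614542513431510244066443424605500510446441206, 662312666114113102666323122114563620124404512,
  134140521224644063530354543104446536165421630, 404546400321020060512426031521336632563446506,
  331232021311003060004366162641116664424334136, 325145252461536620212522304103143521620225502,
  444031066042056552300124425122111323046104320, 544021002005420550405361564111210556013506625,
  226044265551662316646330665510402313130203221, 26035300014604505046121206605655122225031032,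
  11231522321111116050602545002120314133636030, 130224461216262055640606215061201160230060210,
  324421155311615465504436356401146025645664533, 314646561510542505044026600216252141106644456,
  436541042025431163226102151332164534522202363, 202240522442133560203006432605104426314666310,
  325143230413234452033356266236054320046040524, 604334133123532154436561654526212500522000405,
  310433413514235533406304516034133466030616261, 211301204334422110431303500412364065533451452,
  65154445464063152162662066446206425653325521, 143244646112663563364604111034425061365454333,
  300565646064232512166630651026035500254001654, 426425216101441616352525366465035563636563324,
  451213612423402150016105503205565553010101566]

def wFCode : List ℕ :=
  [3204, 2436, 3460, 3716, 132, 1412, 2692, 2500, 196, 1476, 3476, 3732, 148, 1428, 2708, 212,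
  1492, 228, 1508, 1284, 2564, 2644, 200, 3736, 152, 2712, 216, 232, 1288, 2568, 156, 1292, 217,
  233, 1289, 2569, 1293, 1294, 2640]

def wFCol : List ℕ :=
  [0, 1, 2, 3, 4, 5, 6, 7, 8, 9, 10, 11, 12, 13, 14, 15, 16, 17, 18, 19, 20, 21, 22, 23, 24, 26,
  27, 28, 29, 30, 31, 32, 33, 34, 35, 36, 37, 38, 39]

def wFM : List ℕ :=
  [350332451411342066515044621115436320234, 243214562110212156562143353115062200420,
  564245255031323242552154326532244410631, 655335330455412406201430630204444144331,
  154625360436656000505164435506006446221, 635530426205206422200320552450544316411,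
  106626436020114266421564063363062225312, 623402313633131312240620463111032620666,
  664663130215403033623663655636200625113, 405346603166401546100434310556552245213,
  505321132544000515002043061133055060222, 220300032206221026323620516015050432342,
  203321610563350163454234500132005333362, 33065112666205633300123451106064063612,
  302551304550630506035263643345060656354, 602140660165130221436236523020102616006,
  615341116446304624300144436161635026046, 515663510523024403005210154204203400651,
  145341231620202321000040223222531105531, 126361030044301366000254434163102604050,
  406665430634630544130611115532002245120, 202233336321504126600103351262653214220,
  351105126465412060524220563626252350025, 201335344155620432313304232615302041660,
  652410535006523150050411425126035645160, 211611653360234341651561426265003023020,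
  111544542264553240131554335064121353553, 312446410364663400403664356003224330333,
  364124146622215350100033464641150411025, 532603106545066510636640335021044113166,
  263036204226665155341606515014553503444, 116460513323401330400364143615414542031,
  105325005654410112565226414016165210416, 466514225256315346621444163164262540516,
  50265252444213334500632153162143163053, 2642024112220524242235142633044322155,
  314062226536623302500424214025522526052, 552614461453464336000263554125421300015,
  44215151512551005400541210106066360060]

def wFX : List ℕ :=
  [354500422510665446425606624132421050520, 114433255303522503551050154005605634303,
  552525646214433322642034255131452340514, 652614311000064014066232402002541353066,
  63606626661246130302216522524152505036, 426533144316563134522666030030062145562,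
  364620230661403062354030656224625363420, 506250521423040045225130062265525201020,
  22400062143555142353062101322120261404, 651315204303165506364006224666511114323,
  460344425354504465065321044565664053403, 56203335663446234100031130551554441620,
  33415555026362006453353544212350445633, 400262426151023555554523541415454214414,
  523110014050344212443605235451431640032, 162135204104636156631124131444333050116,
  353605464415030043460011003033362342016, 301050345066060232301260026025531464204,
  161452646105123136213006215150204264216, 155333355021546325040420061163655553565,
  333504135156041513062144425054151263043, 545332503626124030516464641104352406026,
  436122161636410352125340604462245410530, 421130254623630352160411562066602524426,
  415006154622554065551134221303505540304, 331645036262303453112533150506066155464,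
  420065635440424314003415603231260604513, 640033600166151243525100415436134066125,
  214323013163152036156442132450654535220, 60334432600122303133620120226505353421,
  133362553662214223320331633630441643666, 445516530124652013221311354405144600611,
  464404130433101303301022340421201020151, 543313160012256245525441325612142365614,
  532525332563261506532332123563621014055, 350535353050565343350255162244435626165,
  234540065466223630262055545624403600364, 64666122411114533024035440304606636514,
  442564230520532232365155143630411430564]

/-! ### Modular computation on natural numbers (here `6` plays the role of `-1`) -/

def wU (n k : ℕ) : ℕ := (n + 2) ^ (k + 1) % 101 % 7

def wEntN (n i j : ℕ) : ℕ :=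
  if i = 3 ∧ j = 3 then 6 * (wU n 0 + wU n 2 + wU n 8) else wU n (i * i + j * j)

def wCmN (a b : ℕ → ℕ → ℕ) (p q : ℕ) : ℕ :=
  (a p 0 * b 0 q + a p 1 * b 1 q + a p 2 * b 2 q + a p 3 * b 3 q) +
  6 * (b p 0 * a 0 q + b p 1 * a 1 q + b p 2 * a 2 q + b p 3 * a 3 q)

def wKvN (a b c : ℕ → ℕ → ℕ) (p q r s : ℕ) : ℕ :=
  wCmN a b p q * c r s + wCmN b c p q * a r s + wCmN c a p q * b r s

def wMulN (a b : ℕ → ℕ → ℕ) (p q : ℕ) : ℕ :=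
  a p 0 * b 0 q + a p 1 * b 1 q + a p 2 * b 2 q + a p 3 * b 3 q

def wHN (s : ℕ → ℕ → ℕ) (i j : ℕ) : ℕ :=
  4 * s i j + if i = j then 6 * (s 0 0 + s 1 1 + s 2 2 + s 3 3) else 0

def wDetN (a b c : ℕ → ℕ → ℕ) (x y x' y' x'' y'' : ℕ) : ℕ :=
  a x y * (b x' y' * c x'' y'' + 6 * (b x'' y'' * c x' y')) +
  6 * (a x' y' * (b x y * c x'' y'' + 6 * (b x'' y'' * c x y))) +
  a x'' y'' * (b x y * c x' y' + 6 * (b x' y' * c x y))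

def wKN (c n : ℕ) : ℕ :=
  wKvN (wEntN (3 * n)) (wEntN (3 * n + 1)) (wEntN (3 * n + 2))
    (c % 4) (c / 4 % 4) (c / 16 % 4) (c / 64 % 4)

def wFN (c n : ℕ) : ℕ :=
  wDetN (wEntN n) (wHN (wMulN (wEntN n) (wEntN n)))
    (wHN (wMulN (wEntN n) (wMulN (wEntN n) (wEntN n))))
    (c % 4) (c / 4 % 4) (c / 16 % 4) (c / 64 % 4) (c / 256 % 4) (c / 1024 % 4)

/-- Digit `k` of `r`. -/
def wDig (r k : ℕ) : ℕ := r / 10 ^ k % 10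

def wDot (r c : ℕ) : ℕ → ℕ
  | 0 => 0
  | k + 1 => wDot r c k + wDig r k * wDig c k

theorem wDot_eq (r c n : ℕ) : wDot r c n = ∑ k : Fin n, wDig r k * wDig c k := by
  induction n with
  | zero => rfl
  | succ n ih => rw [Fin.sum_univ_castSucc, wDot, ih]; rfl

theorem wK_check1 : ∀ i < 45, ∀ j < 45,
    wKN (wKCode.getD i 0) (wKCol.getD j 0) % 7 = wDig (wKM.getD i 0) j := by
  decide +kernel

theorem wK_check2 : ∀ i < 45, ∀ j < 45,
    wDot (wKM.getD i 0) (wKX.getD j 0) 45 % 7 = if i = j then 1 else 0 := by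
  decide +kernel

theorem wF_check1 : ∀ i < 39, ∀ j < 39,
    wFN (wFCode.getD i 0) (wFCol.getD j 0) % 7 = wDig (wFM.getD i 0) j := by
  decide +kernel

theorem wF_check2 : ∀ i < 39, ∀ j < 39,
    wDot (wFM.getD i 0) (wFX.getD j 0) 39 % 7 = if i = j then 1 else 0 := by
  decide +kernel

/-! ### The linear independence criterion -/

theorem w_crit {V : Type*} [AddCommGroup V] [Module ℝ V] (n : ℕ) (f : Fin n → V)
    (ev : Fin n → V →ₗ[ℝ] ℝ) (Z : Matrix (Fin n) (Fin n) ℤ)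
    (hZ : ∀ i j, ev j (f i) = (Z i j : ℝ)) (N : ℕ → ℕ → ℕ) (M X : List ℕ)
    (hN : ∀ i j : Fin n, ((Z i j : ℤ) : ZMod 7) = ((N i j : ℕ) : ZMod 7))
    (h1 : ∀ i < n, ∀ j < n, N i j % 7 = wDig (M.getD i 0) j)
    (h2 : ∀ i < n, ∀ j < n, wDot (M.getD i 0) (X.getD j 0) n % 7 = if i = j then 1 else 0) :
    LinearIndependent ℝ f := by
  have hprod : (Z.map (Int.castRingHom (ZMod 7))) *
      (Matrix.of fun k j : Fin n => ((wDig (X.getD j 0) k : ℕ) : ZMod 7)) = 1 := by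
    ext i j
    have e : ∀ k : Fin n, (Z.map (Int.castRingHom (ZMod 7))) i k
        = ((wDig (M.getD i 0) k : ℕ) : ZMod 7) := by
      intro k
      rw [Matrix.map_apply, ← h1 i i.2 k k.2, ZMod.natCast_mod, ← hN]
      rfl
    rw [Matrix.mul_apply]
    simp only [e, Matrix.of_apply]
    have := h2 i i.2 j j.2
    rw [wDot_eq] at this
    have h3 := congrArg (Nat.cast : ℕ → ZMod 7) this
    rw [ZMod.natCast_mod] at h3
    push_cast at h3
    rw [h3, Matrix.one_apply]
    simp [Fin.ext_iff]
  have hdet : Z.det ≠ 0 := by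
    intro h0
    have h4 := congrArg Matrix.det hprod
    rw [Matrix.det_mul, Matrix.det_one] at h4
    have h5 : (Z.map (Int.castRingHom (ZMod 7))).det = 0 := by
      have := (Int.castRingHom (ZMod 7)).map_det Z
      rw [h0, map_zero] at this
      exact this.symm
    rw [h5, zero_mul] at h4
    exact absurd h4 (by decide)
  have hdetR : (Z.map (Int.castRingHom ℝ)).det ≠ 0 := by
    have := (Int.castRingHom ℝ).map_det Z
    intro h
    rw [RingHom.mapMatrix_apply, h] at this
    exact hdet (by simpa using this)
  rw [Fintype.linearIndependent_iff]
  intro g hg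
  have hv : Matrix.vecMul g (Z.map (Int.castRingHom ℝ)) = 0 := by
    ext j
    have := congrArg (ev j) hg
    simp only [map_sum, map_smul, hZ, map_zero, smul_eq_mul] at this
    simpa [Matrix.vecMul, dotProduct] using this
  exact fun i => congrFun (Matrix.eq_zero_of_vecMul_eq_zero hdetR hv) i

/-! ### The same computation over a commutative ring -/

section ring
variable {R S : Type*} [CommRing R] [CommRing S]

def wKv (a b c : Matrix (Fin 4) (Fin 4) R) (p q r s : Fin 4) : R :=
  (a * b - b * a) p q * c r s + (b * c - c * b) p q * a r s + (c * a - a * c) p q * b r s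

def wH (s : Matrix (Fin 4) (Fin 4) R) : Matrix (Fin 4) (Fin 4) R :=
  (4 : R) • s - s.trace • 1

def wDet (a b c : Matrix (Fin 4) (Fin 4) R) (x y x' y' x'' y'' : Fin 4) : R :=
  a x y * (b x' y' * c x'' y'' - b x'' y'' * c x' y') -
  a x' y' * (b x y * c x'' y'' - b x'' y'' * c x y) +
  a x'' y'' * (b x y * c x' y' - b x' y' * c x y)

theorem wKv_map (φ : R →+* S) (a b c : Matrix (Fin 4) (Fin 4) R) (p q r s : Fin 4) :
    φ (wKv a b c p q r s) = wKv (a.map φ) (b.map φ) (c.map φ) p q r s := by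
  simp [wKv, Matrix.mul_apply]

theorem wH_map (φ : R →+* S) (s : Matrix (Fin 4) (Fin 4) R) :
    (wH s).map φ = wH (s.map φ) := by
  ext i j
  have h4 : φ 4 = 4 := map_ofNat φ 4
  simp [wH, Matrix.one_apply, Matrix.trace, apply_ite φ, h4]

theorem wDet_map (φ : R →+* S) (a b c : Matrix (Fin 4) (Fin 4) R) (x y x' y' x'' y'' : Fin 4) :
    φ (wDet a b c x y x' y' x'' y'') =
      wDet (a.map φ) (b.map φ) (c.map φ) x y x' y' x'' y'' := by
  simp [wDet]

def wNM (a : ℕ → ℕ → ℕ) : Matrix (Fin 4) (Fin 4) (ZMod 7) := Matrix.of fun i j => (a i j : ZMod 7)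

theorem w_six : (6 : ZMod 7) = -1 := by decide

theorem wKv_nat (a b c : ℕ → ℕ → ℕ) (p q r s : Fin 4) :
    wKv (wNM a) (wNM b) (wNM c) p q r s = ((wKvN a b c p q r s : ℕ) : ZMod 7) := by
  simp only [wKv, wKvN, wCmN, wNM, Matrix.sub_apply, Matrix.mul_apply, Fin.sum_univ_four,
    Matrix.of_apply]
  push_cast
  simp only [w_six]
  simp
  ring

theorem wMul_nat (a b : ℕ → ℕ → ℕ) : wNM a * wNM b = wNM (wMulN a b) := by
  ext i j
  simp [wNM, wMulN, Matrix.mul_apply, Fin.sum_univ_four]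

theorem wH_nat (a : ℕ → ℕ → ℕ) : wH (wNM a) = wNM (wHN a) := by
  ext i j
  by_cases h : i = j
  · subst h
    simp [wNM, wHN, wH, Matrix.trace, Fin.sum_univ_four, w_six]
    ring
  · have h' : (i : ℕ) ≠ j := fun e => h (Fin.ext e)
    simp [wNM, wHN, wH, h, h']

theorem wDet_nat (a b c : ℕ → ℕ → ℕ) (x y x' y' x'' y'' : Fin 4) :
    wDet (wNM a) (wNM b) (wNM c) x y x' y' x'' y'' =
      ((wDetN a b c x y x' y' x'' y'' : ℕ) : ZMod 7) := by
  simp only [wDet, wDetN, wNM, Matrix.of_apply]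
  push_cast
  simp only [w_six]
  ring

end ring

/-- The test matrices, over the integers. -/
def wZ (n : ℕ) : Matrix (Fin 4) (Fin 4) ℤ := Matrix.of fun i j =>
  if i = 3 ∧ j = 3 then -((wU n 0 : ℤ) + wU n 2 + wU n 8)
    else (wU n ((i : ℕ) * i + (j : ℕ) * j) : ℤ)

theorem wZ_mod (n : ℕ) : (wZ n).map (Int.castRingHom (ZMod 7)) = wNM (wEntN n) := by
  ext i j
  have e : ((i : ℕ) = 3 ∧ (j : ℕ) = 3) ↔ (i = 3 ∧ j = 3) := by
    simp [Fin.ext_iff]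
  by_cases h : i = 3 ∧ j = 3
  · have h' := e.2 h
    simp only [wZ, wNM, wEntN, Matrix.map_apply, Matrix.of_apply, if_pos h, if_pos h']
    push_cast
    simp only [w_six]
    simp
    try ring
  · have h' := fun t => h (e.1 t)
    simp only [wZ, wNM, wEntN, Matrix.map_apply, Matrix.of_apply, if_neg h, if_neg h']
    simp

/-- The test matrices, as elements of `N`. -/
noncomputable def wR (n : ℕ) : symTraceless 4 :=
  ⟨(wZ n).map (Int.castRingHom ℝ), by
    refine mem_symTraceless.mpr ⟨?_, ?_⟩
    · ext i j
      simp only [wZ, Matrix.transpose_apply, Matrix.map_apply, Matrix.of_apply]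
      simp only [and_comm, add_comm]
    · simp [wZ, Matrix.trace, Fin.sum_univ_four]⟩

/-! ### Alternating forms -/

/-- Entry `(p, q)` as a linear form on `N`. -/
def wEnt (p q : Fin 4) : symTraceless 4 →ₗ[ℝ] ℝ :=
  (Matrix.entryLinearMap ℝ ℝ p q).comp (symTraceless 4).subtype

noncomputable def wOm (x y x' y' x'' y'' : Fin 4) : symTraceless 4 [⋀^Fin 3]→ₗ[ℝ] ℝ :=
  (Matrix.detRowAlternating (n := Fin 3) (R := ℝ)).compLinearMap
    (LinearMap.pi ![wEnt x y, wEnt x' y', wEnt x'' y''])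

theorem wOm_apply (a b c : symTraceless 4) (x y x' y' x'' y'' : Fin 4) :
    wOm x y x' y' x'' y'' ![a, b, c] = wDet a.1 b.1 c.1 x y x' y' x'' y'' := by
  have : wOm x y x' y' x'' y'' ![a, b, c] =
    Matrix.det !![a.1 x y, a.1 x' y', a.1 x'' y''; b.1 x y, b.1 x' y', b.1 x'' y'';
      c.1 x y, c.1 x' y', c.1 x'' y''] := by
    change Matrix.det (R := ℝ) (n := Fin 3) _ = _
    congr 1
    ext i j
    fin_cases i <;> fin_cases j <;> rfl
  rw [this, Matrix.det_fin_three]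
  simp [wDet]
  ring

noncomputable def wKa (p q r s : Fin 4) : symTraceless 4 [⋀^Fin 3]→ₗ[ℝ] ℝ :=
  ∑ t : Fin 4, wOm p t t q r s

theorem wKa_apply (a b c : symTraceless 4) (p q r s : Fin 4) :
    wKa p q r s ![a, b, c] = wKv a.1 b.1 c.1 p q r s := by
  simp only [wKa, Fin.sum_univ_four, AlternatingMap.add_apply, wOm_apply, wDet, wKv,
    Matrix.mul_apply, Matrix.sub_apply]
  ring

/-- Evaluation at a decomposable trivector. -/
def wEvl (v : Fin 3 → symTraceless 4) : (symTraceless 4 [⋀^Fin 3]→ₗ[ℝ] ℝ) →ₗ[ℝ] ℝ where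
  toFun ω := ω v
  map_add' _ _ := rfl
  map_smul' _ _ := rfl

/-- The map from alternating forms to functions on `N`. -/
noncomputable def wT : (symTraceless 4 [⋀^Fin 3]→ₗ[ℝ] ℝ) →ₗ[ℝ] (symTraceless 4 → ℝ) where
  toFun ω := fun A => ω ![A, H4 2 A, H4 3 A]
  map_add' _ _ := rfl
  map_smul' _ _ := rfl

theorem wT_wKa (p q r s : Fin 4) : wT (wKa p q r s) = 0 := by
  ext A
  change wKa p q r s ![A, H4 2 A, H4 3 A] = 0
  have c : ∀ i j : ℕ, Commute (A.1 ^ i - ((A.1 ^ i).trace / 4) • (1 : Matrix (Fin 4) (Fin 4) ℝ))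
      (A.1 ^ j - ((A.1 ^ j).trace / 4) • 1) := by
    intro i j
    refine Commute.sub_left (Commute.sub_right ?_ ?_) (Commute.sub_right ?_ ?_)
    · exact (Commute.refl A.1).pow_pow i j
    · exact (Commute.one_right _).smul_right _
    · exact (Commute.one_left _).smul_left _
    · exact ((Commute.one_left _).smul_left _).smul_right _ 
  have c' : ∀ j : ℕ, Commute A.1 (A.1 ^ j - ((A.1 ^ j).trace / 4) • 1) := by
    intro j
    refine Commute.sub_right ?_ ?_
    · exact (Commute.refl A.1).pow_right j
    · exact (Commute.one_right _).smul_right _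
  have e1 : A.1 * (H4 2 A).1 = (H4 2 A).1 * A.1 := c' 2
  have e2 : A.1 * (H4 3 A).1 = (H4 3 A).1 * A.1 := c' 3
  have e3 : (H4 2 A).1 * (H4 3 A).1 = (H4 3 A).1 * (H4 2 A).1 := c 2 3
  rw [wKa_apply, wKv, e1, e2, e3]
  simp

theorem wH4 (i : ℕ) (A : symTraceless 4) : wH (A.1 ^ i) = (4 : ℝ) • (H4 i A).1 := by
  simp only [wH, H4, smul_sub, smul_smul]
  congr 2
  ring

/-- The 45 relations. -/
noncomputable def wKf (i : Fin 45) : symTraceless 4 [⋀^Fin 3]→ₗ[ℝ] ℝ :=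
  let c := wKCode.getD i 0
  wKa (Fin.ofNat 4 c) (Fin.ofNat 4 (c / 4)) (Fin.ofNat 4 (c / 16)) (Fin.ofNat 4 (c / 64))

/-- The 39 coordinate forms. -/
noncomputable def wFf (i : Fin 39) : symTraceless 4 [⋀^Fin 3]→ₗ[ℝ] ℝ :=
  let c := wFCode.getD i 0
  wOm (Fin.ofNat 4 c) (Fin.ofNat 4 (c / 4)) (Fin.ofNat 4 (c / 16)) (Fin.ofNat 4 (c / 64))
    (Fin.ofNat 4 (c / 256)) (Fin.ofNat 4 (c / 1024))

theorem wKf_li : LinearIndependent ℝ wKf := by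
  refine w_crit 45 wKf
    (fun j => wEvl ![wR (3 * wKCol.getD j 0), wR (3 * wKCol.getD j 0 + 1),
      wR (3 * wKCol.getD j 0 + 2)])
    (Matrix.of fun i j => wKv (wZ (3 * wKCol.getD j 0)) (wZ (3 * wKCol.getD j 0 + 1))
      (wZ (3 * wKCol.getD j 0 + 2)) (Fin.ofNat 4 (wKCode.getD i 0))
      (Fin.ofNat 4 (wKCode.getD i 0 / 4)) (Fin.ofNat 4 (wKCode.getD i 0 / 16))
      (Fin.ofNat 4 (wKCode.getD i 0 / 64))) ?_
    (fun i j => wKN (wKCode.getD i 0) (wKCol.getD j 0)) wKM wKX ?_ wK_check1 wK_check2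
  · intro i j
    change wKa _ _ _ _ ![_, _, _] = _
    rw [wKa_apply]
    exact (wKv_map (Int.castRingHom ℝ) _ _ _ _ _ _ _).symm
  · intro i j
    refine (wKv_map (Int.castRingHom (ZMod 7)) _ _ _ _ _ _ _).trans ?_
    rw [wZ_mod, wZ_mod, wZ_mod, wKv_nat]
    rfl

theorem wTFf_li : LinearIndependent ℝ (fun i => wT (wFf i)) := by
  refine w_crit 39 (fun i => wT (wFf i))
    (fun j => (16 : ℝ) • LinearMap.proj (wR (wFCol.getD j 0)))
    (Matrix.of fun i j => wDet (wZ (wFCol.getD j 0))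
      (wH (wZ (wFCol.getD j 0) * wZ (wFCol.getD j 0)))
      (wH (wZ (wFCol.getD j 0) * (wZ (wFCol.getD j 0) * wZ (wFCol.getD j 0))))
      (Fin.ofNat 4 (wFCode.getD i 0))
      (Fin.ofNat 4 (wFCode.getD i 0 / 4)) (Fin.ofNat 4 (wFCode.getD i 0 / 16))
      (Fin.ofNat 4 (wFCode.getD i 0 / 64)) (Fin.ofNat 4 (wFCode.getD i 0 / 256))
      (Fin.ofNat 4 (wFCode.getD i 0 / 1024))) ?_
    (fun i j => wFN (wFCode.getD i 0) (wFCol.getD j 0)) wFM wFX ?_ wF_check1 wF_check2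
  · intro i j
    refine Eq.trans ?_ (wDet_map (Int.castRingHom ℝ) _ _ _ _ _ _ _ _ _).symm
    rw [wH_map, wH_map, Matrix.map_mul, Matrix.map_mul, Matrix.map_mul]
    have hz : (wZ (wFCol.getD j 0)).map (Int.castRingHom ℝ) = (wR (wFCol.getD j 0)).1 := rfl
    rw [hz]
    generalize wR (wFCol.getD j 0) = A
    have e2 : A.1 * A.1 = A.1 ^ 2 := (pow_two _).symm
    have e3 : A.1 * A.1 ^ 2 = A.1 ^ 3 := (pow_succ' _ _).symm
    rw [e2, e3, wH4, wH4]
    change (16 : ℝ) * (wOm _ _ _ _ _ _ ![A, H4 2 A, H4 3 A]) = _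
    rw [wOm_apply]
    simp only [wDet, Matrix.smul_apply, smul_eq_mul]
    ring
  · intro i j
    refine (wDet_map (Int.castRingHom (ZMod 7)) _ _ _ _ _ _ _ _ _).trans ?_
    rw [wH_map, wH_map, Matrix.map_mul, Matrix.map_mul, Matrix.map_mul, wZ_mod, wMul_nat, wMul_nat, wH_nat,
      wH_nat, wDet_nat]
    rfl

/-! ### Dimension count -/

theorem w_finrank_N : Module.finrank ℝ (symTraceless 4) ≤ 9 := by
  let L : symTraceless 4 →ₗ[ℝ] (Fin 9 → ℝ) := LinearMap.pi
    ![wEnt 0 0, wEnt 1 1, wEnt 2 2, wEnt 0 1, wEnt 0 2, wEnt 0 3, wEnt 1 2, wEnt 1 3, wEnt 2 3]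
  have hL : Function.Injective L := by
    rw [← LinearMap.ker_eq_bot, LinearMap.ker_eq_bot']
    intro A hA
    have h : ∀ k, L A k = 0 := fun k => congrFun hA k
    obtain ⟨hs, ht⟩ := mem_symTraceless.mp A.2
    have h0 : A.1 0 0 = 0 := h 0
    have h1 : A.1 1 1 = 0 := h 1
    have h2 : A.1 2 2 = 0 := h 2
    have h3 : A.1 0 1 = 0 := h 3
    have h4 : A.1 0 2 = 0 := h 4
    have h5 : A.1 0 3 = 0 := h 5
    have h6 : A.1 1 2 = 0 := h 6
    have h7 : A.1 1 3 = 0 := h 7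
    have h8 : A.1 2 3 = 0 := h 8
    have h9 : A.1 3 3 = 0 := by
      simp only [Matrix.trace, Fin.sum_univ_four, Matrix.diag_apply] at ht
      linarith
    have s : ∀ i j, A.1 i j = A.1 j i := fun i j => (hs.apply i j).symm
    apply Subtype.ext
    ext i j
    fin_cases i <;> fin_cases j <;>
      first
      | assumption
      | (refine (s _ _).trans ?_; assumption)
  have := LinearMap.finrank_le_finrank_of_injective hL
  simpa using this

/-- For `n = 4`, the span of the coordinate functions `A ↦ ξ(A ∧ H₂(A) ∧ H₃(A))` of the
wedge map on the space `N` of trace-zero real symmetric `4 × 4` matrices, as `ξ` ranges over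
the linear forms on `⋀³ N`, has dimension `39 = 7 + 7 + 25`. -/
theorem finrank_image_wedge_map_four :
    Module.finrank ℝ ↥(Submodule.span ℝ {f : ↥(symTraceless 4) → ℝ |
      ∃ ξ : Module.Dual ℝ ↥(⋀[ℝ]^3 ↥(symTraceless 4)),
        f = fun A => ξ (wedge3 A (H4 2 A) (H4 3 A))}) = 39 := by
  have hset : {f : ↥(symTraceless 4) → ℝ |
      ∃ ξ : Module.Dual ℝ ↥(⋀[ℝ]^3 ↥(symTraceless 4)),
        f = fun A => ξ (wedge3 A (H4 2 A) (H4 3 A))} = (LinearMap.range wT : Set _) := by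
    ext f
    constructor
    · rintro ⟨ξ, rfl⟩
      exact ⟨exteriorPower.alternatingMapLinearEquiv.symm ξ, by
        ext A
        exact exteriorPower.alternatingMapLinearEquiv_symm_apply ξ _⟩
    · rintro ⟨ω, rfl⟩
      refine ⟨exteriorPower.alternatingMapLinearEquiv ω, ?_⟩
      ext A
      exact (exteriorPower.alternatingMapLinearEquiv_apply_ιMulti ω _).symm
  rw [hset, Submodule.span_eq]
  let e := exteriorPower.alternatingMapLinearEquiv (R := ℝ) (n := 3) (M := symTraceless 4) (N := ℝ)
  have : Module.Finite ℝ (symTraceless 4 [⋀^Fin 3]→ₗ[ℝ] ℝ) :=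
    Module.Finite.equiv e.symm
  have hd : Module.finrank ℝ (symTraceless 4 [⋀^Fin 3]→ₗ[ℝ] ℝ) ≤ 84 := by
    have h1 : Module.finrank ℝ (Module.Dual ℝ ↥(⋀[ℝ]^3 ↥(symTraceless 4))) =
        Module.finrank ℝ ↥(⋀[ℝ]^3 ↥(symTraceless 4)) := Subspace.dual_finrank_eq
    rw [e.finrank_eq]
    refine h1.le.trans ?_
    rw [exteriorPower.finrank_eq]
    exact (Nat.choose_le_choose 3 w_finrank_N).trans (by decide)
  have hk : 45 ≤ Module.finrank ℝ (LinearMap.ker wT) := by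
    have hli : LinearIndependent ℝ
        (fun i => (⟨wKf i, LinearMap.mem_ker.mpr (wT_wKa _ _ _ _)⟩ : LinearMap.ker wT)) :=
      LinearIndependent.of_comp (LinearMap.ker wT).subtype wKf_li
    simpa using hli.fintype_card_le_finrank
  have hr : 39 ≤ Module.finrank ℝ (LinearMap.range wT) := by
    have hli : LinearIndependent ℝ
        (fun i => (⟨wT (wFf i), ⟨wFf i, rfl⟩⟩ : LinearMap.range wT)) :=
      LinearIndependent.of_comp (LinearMap.range wT).subtype wTFf_li
    simpa using hli.fintype_card_le_finrank
  have hs := LinearMap.finrank_range_add_finrank_ker wT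
  omega
end

section
/- Let n ≥ 2. If f is a polynomial function on N of total degree strictly less than n(n−1)/2 that vanishes identically on F, then f = 0. In other words, no nonzero polynomial of degree less than n(n−1)/2 vanishes on the set of degenerate trace-zero real symmetric n×n matrices. -/
open Matrix BigOperators

theorem exists_generic_aux (n : ℕ) (l : Fin n → ℝ) (hl : Function.Injective l) :
    ∃ m : Fin n → ℝ, Function.Injective m ∧ ∀ i j k r : Fin n, j < i → r < k →
      (l i - l j) * (m k - m r) = (l k - l r) * (m i - m j) → i = k ∧ j = r := by
  classical
  let P : Fin n × Fin n × Fin n × Fin n → Polynomial ℝ := fun x =>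
    Polynomial.C (l x.1 - l x.2.1) * (Polynomial.X ^ (x.2.2.1 : ℕ) - Polynomial.X ^ (x.2.2.2 : ℕ))
     - Polynomial.C (l x.2.2.1 - l x.2.2.2) *
       (Polynomial.X ^ (x.1 : ℕ) - Polynomial.X ^ (x.2.1 : ℕ))
  have hfin : (⋃ x, {c : ℝ | P x ≠ 0 ∧ (P x).IsRoot c}).Finite := by
    refine Set.finite_iUnion fun x => ?_
    by_cases h : P x = 0
    · simp [h]
    · exact (Polynomial.finite_setOfPred_isRoot h).subset fun c hc => hc.2
  obtain ⟨c, hc1, hc2⟩ := (Set.Ioi_infinite (1 : ℝ)).exists_notMem_finset hfin.toFinset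
  have hc1' : 1 < c := hc1
  refine ⟨fun i => c ^ (i : ℕ), fun i j h => ?_, fun i j k r hij hkr h => ?_⟩
  · exact Fin.ext ((pow_right_injective₀ (by linarith) hc1'.ne') h)
  · have hP : P (i, j, k, r) = 0 := by
      by_contra hne
      apply hc2
      simp only [Set.Finite.mem_toFinset, Set.mem_iUnion]
      refine ⟨(i, j, k, r), hne, ?_⟩
      simp only [P, Polynomial.IsRoot, Polynomial.eval_sub, Polynomial.eval_mul,
        Polynomial.eval_C, Polynomial.eval_pow, Polynomial.eval_X]
      linarith
    have hlij : l i - l j ≠ 0 := sub_ne_zero.mpr fun h => hij.ne' (hl h)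
    have hlkr : l k - l r ≠ 0 := sub_ne_zero.mpr fun h => hkr.ne' (hl h)
    have hco : ∀ a : Fin n, (l i - l j) * ((if a = k then 1 else 0) - (if a = r then 1 else 0))
        - (l k - l r) * ((if a = i then 1 else 0) - (if a = j then 1 else 0)) = 0 := by
      intro a
      have := congrArg (fun q => Polynomial.coeff q (a : ℕ)) hP
      simpa only [P, Polynomial.coeff_sub, Polynomial.coeff_C_mul, Polynomial.coeff_X_pow,
        Polynomial.coeff_zero, Fin.val_inj] using this
    have h1 : k = i ∨ k = j := by
      by_contra hcon
      push Not at hcon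
      have := hco k
      simp [hcon.1, hcon.2, hkr.ne', hlij] at this
    have h2 : r = i ∨ r = j := by
      by_contra hcon
      push Not at hcon
      have := hco r
      simp [hcon.1, hcon.2, hkr.ne] at this
      exact hlij (by linarith)
    rcases h1 with h1 | h1 <;> rcases h2 with h2 | h2
    · subst h1; subst h2; exact absurd hkr (lt_irrefl _)
    · exact ⟨h1.symm, h2.symm⟩
    · subst h1; subst h2; exact absurd hkr (lt_asymm hij)
    · subst h1; subst h2; exact absurd hkr (lt_irrefl _)

theorem degen_of_conj_aux {n : ℕ} (U : unitary (Matrix (Fin n) (Fin n) ℝ)) (d : Fin n → ℝ)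
    (B : symTraceless n) (hB : B.1 = (U : Matrix (Fin n) (Fin n) ℝ) * diagonal d *
      (star U : Matrix (Fin n) (Fin n) ℝ)) (i j : Fin n) (hij : i ≠ j) (hd : d i = d j) :
    Degen B := by
  by_contra hcon
  have hinj : Function.Injective (eigsN B) := by
    intro a b hab
    by_contra hne
    exact hcon ⟨a, b, hne, hab⟩
  have h1 := (isHermitian_of_isSymm (mem_symTraceless.mp B.2).1).roots_charpoly_eq_eigenvalues
  have h2 : B.1.charpoly = ∏ i, (Polynomial.X - Polynomial.C (d i)) := by
    rw [hB, charpoly_mul_comm, ← mul_assoc]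
    simp [charpoly_diagonal]
  have h3 : B.1.charpoly.roots = Multiset.map d Finset.univ.val := by
    rw [h2, Polynomial.roots_prod]
    · simp
    · simp [Finset.prod_ne_zero_iff, Polynomial.X_sub_C_ne_zero]
  have h4 : (Multiset.map (eigsN B) Finset.univ.val).Nodup :=
    Finset.univ.nodup.map hinj
  have h5 : Multiset.map d Finset.univ.val = Multiset.map (eigsN B) Finset.univ.val :=
    h3.symm.trans h1
  rw [← h5] at h4
  exact hij (Multiset.inj_on_of_nodup_map h4 i (Finset.mem_univ_val i) j (Finset.mem_univ_val j) hd)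

/-- No nonzero polynomial function on `N` of degree less than `n(n-1)/2` vanishes on the
set `F` of degenerate trace-zero real symmetric matrices: any polynomial of total degree
`< n(n-1)/2` vanishing on `F` vanishes on all of `N`. -/
theorem eq_zero_on_N_of_low_degree (n : ℕ) (hn : 2 ≤ n)
    (p : MvPolynomial (Fin n × Fin n) ℝ)
    (hdeg : p.totalDegree < n * (n - 1) / 2)
    (hvan : ∀ A : ↥(symTraceless n), Degen A → evalMat p A.1 = 0) :
    ∀ A : ↥(symTraceless n), evalMat p A.1 = 0 := by
  intro A
  by_cases hA : Degen A
  · exact hvan A hA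
  have hinj : Function.Injective (eigsN A) := by
    intro a b hab
    by_contra hne
    exact hA ⟨a, b, hne, hab⟩
  obtain ⟨m, hm, hgen⟩ := exists_generic_aux n (eigsN A) hinj
  have hspec := (isHermitian_of_isSymm (mem_symTraceless.mp A.2).1).spectral_theorem
  set U := (isHermitian_of_isSymm (mem_symTraceless.mp A.2).1).eigenvectorUnitary with hU
  have hspec' : A.1 = (U : Matrix (Fin n) (Fin n) ℝ) * diagonal (eigsN A) *
      (star U : Matrix (Fin n) (Fin n) ℝ) := hspec
  have hn0 : (n : ℝ) ≠ 0 := by positivity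
  let s : ℝ := (∑ i, m i) / n
  let m' : Fin n → ℝ := fun i => m i - s
  let B : Matrix (Fin n) (Fin n) ℝ := (U : Matrix (Fin n) (Fin n) ℝ) * diagonal m' *
      (star U : Matrix (Fin n) (Fin n) ℝ)
  have hBmem : B ∈ symTraceless n := by
    refine mem_symTraceless.mpr ⟨?_, ?_⟩
    · simp only [B, Matrix.IsSymm, Matrix.star_eq_conjTranspose,
        Matrix.conjTranspose_eq_transpose_of_trivial, Matrix.transpose_mul,
        Matrix.transpose_transpose, Matrix.diagonal_transpose, Matrix.mul_assoc]
    · simp only [B]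
      rw [Matrix.trace_mul_comm, ← mul_assoc]
      simp only [Unitary.coe_star_mul_self, one_mul, Matrix.trace_diagonal, m', s,
        Finset.sum_sub_distrib, Finset.sum_const, Finset.card_univ, Fintype.card_fin, nsmul_eq_mul]
      field_simp
      ring
  let q : Polynomial ℝ := MvPolynomial.aeval
    (fun ij : Fin n × Fin n => Polynomial.C (B ij.1 ij.2) * Polynomial.X
      + Polynomial.C (A.1 ij.1 ij.2)) p
  have hqdeg : q.natDegree ≤ p.totalDegree := by
    have := MvPolynomial.aeval_natDegree_le p le_rfl
      (fun ij : Fin n × Fin n => Polynomial.C (B ij.1 ij.2) * Polynomial.X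
      + Polynomial.C (A.1 ij.1 ij.2)) (n := 1) (fun _ => Polynomial.natDegree_linear_le)
    simpa using this
  have hqev : ∀ t : ℝ, q.eval t = evalMat p (A.1 + t • B) := by
    intro t
    have h1 : q.eval t = (Polynomial.aeval t) q := by simp [Polynomial.aeval_def, Polynomial.eval₂_eq_eval_map]
    rw [h1]
    simp only [q]
    rw [← AlgHom.comp_apply, MvPolynomial.comp_aeval, evalMat, MvPolynomial.aeval_eq_eval]
    congr 2
    funext ij
    simp
    ring
  let t : (Σ _ : Fin n, Fin n) → ℝ := fun x =>
    -(eigsN A x.1 - eigsN A x.2) / (m x.1 - m x.2)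
  let S : Finset (Σ _ : Fin n, Fin n) := Finset.univ.sigma fun i => Finset.Iio i
  have hScard : S.card = n * (n - 1) / 2 := by
    simp only [S, Finset.card_sigma, Fin.card_Iio]
    rw [Fin.sum_univ_eq_sum_range (fun i => i), Finset.sum_range_id]
  have hmS : ∀ i j : Fin n, j < i → m i - m j ≠ 0 := fun i j h =>
    sub_ne_zero.mpr fun h' => h.ne' (hm h')
  have htinj : Set.InjOn t S := by
    rintro ⟨i, j⟩ hx ⟨k, r⟩ hy hxy
    simp only [S, Finset.coe_sigma, Set.mem_sigma_iff, Finset.mem_coe, Finset.mem_univ,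
      Finset.mem_Iio, true_and] at hx hy
    simp only [t] at hxy
    rw [div_eq_div_iff (hmS _ _ hx) (hmS _ _ hy)] at hxy
    obtain ⟨h1, h2⟩ := hgen i j k r hx hy (by linarith)
    subst h1; subst h2; rfl
  have hq0 : q = 0 := by
    refine Polynomial.eq_zero_of_natDegree_lt_card_of_eval_eq_zero' q (S.image t) ?_ ?_
    · intro y hy
      obtain ⟨⟨i, j⟩, hx, rfl⟩ := Finset.mem_image.mp hy
      simp only [S, Finset.mem_sigma, Finset.mem_univ, Finset.mem_Iio, true_and] at hx
      rw [hqev]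
      let τ := t ⟨i, j⟩
      have hmem : A.1 + τ • B ∈ symTraceless n :=
        (symTraceless n).add_mem A.2 ((symTraceless n).smul_mem τ hBmem)
      refine hvan ⟨A.1 + τ • B, hmem⟩ (degen_of_conj_aux U (eigsN A + τ • m') _ ?_ i j hx.ne' ?_)
      · have hd : diagonal (eigsN A + τ • m') = diagonal (eigsN A) + τ • diagonal m' := by
          rw [← Matrix.diagonal_smul, Matrix.diagonal_add]; rfl
        show A.1 + τ • B = _
        rw [hd, mul_add, add_mul, ← hspec', mul_smul_comm, smul_mul_assoc]
      · have := hmS i j hx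
        simp only [Pi.add_apply, Pi.smul_apply, smul_eq_mul, m', τ, t]
        field_simp
        ring
    · rw [Finset.card_image_of_injOn htinj, hScard]
      omega
  have := hqev 0
  rw [hq0] at this
  simpa using this.symm
end
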